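/- arXiv:1907.08461 — 3 statements merged into one kernel-verified Lean document; each statement's English description precedes it below -/
import Mathlib

section
/- Let A be a finite set, a* ∈ A, N ∈ ℕ⁺, ε ∈ (0, 1/|A|), and η ∈ (0,1). Let (Ω, P) be a probability space with random variables K: Ω → [N] and X: Ω → A. Suppose that for every a ∈ A, P[ P[X=a | K] > 0 ∧ ( a = a* ∨ P[X=a* | K] ≤ ε ) ] ≤ 1 − η. Then the mutual information satisfies I(K; X) ≥ η · ln( 1 + ε(1−ε)^{1/ε − 1} ). -/
open MeasureTheory
open scoped BigOperators

/-- Pointwise form of the Gibbs (Donsker-Varadhan) inequality. -/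
lemma add_sub_mul_exp_le_mul_log_div {x y : ℝ} (hx : 0 ≤ x) (hy : 0 ≤ y) (hxy : y = 0 → x = 0)
    (s : ℝ) : x * s + x - y * Real.exp s ≤ x * Real.log (x / y) := by
  rcases hx.eq_or_lt with rfl | hx
  · have := mul_nonneg hy (Real.exp_pos s).le
    simpa using this
  have hy : 0 < y := hy.lt_of_ne fun h => hx.ne' (hxy h.symm)
  have h := Real.log_le_sub_one_of_pos (show 0 < y * Real.exp s / x by positivity)
  have hlog : Real.log (y * Real.exp s / x) = s - Real.log (x / y) := by
    rw [Real.log_div (by positivity) hx.ne', Real.log_mul hy.ne' (Real.exp_pos s).ne',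
      Real.log_exp, Real.log_div hx.ne' hy.ne']
    ring
  rw [hlog] at h
  have h' := mul_le_mul_of_nonneg_left h hx.le
  have hcancel : x * (y * Real.exp s / x - 1) = y * Real.exp s - x := by field_simp
  linarith

lemma measureReal_eq_sum_fiber {Ω ι : Type*} [MeasurableSpace Ω] [Fintype ι] (P : Measure Ω)
    [IsFiniteMeasure P] (f : Ω → ι) (hf : ∀ i, MeasurableSet {ω | f ω = i}) {S : Set Ω}
    (hS : MeasurableSet S) : P.real S = ∑ i, P.real {ω | f ω = i ∧ ω ∈ S} := by
  have hU : S = ⋃ i ∈ (Finset.univ : Finset ι), {ω | f ω = i ∧ ω ∈ S} := by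
    ext ω
    simp
  conv_lhs => rw [hU]
  refine measureReal_biUnion_finset ?_ fun i _ => (hf i).inter hS
  intro i _ j _ hij
  refine Set.disjoint_left.mpr fun ω hi hj => hij ?_
  exact hi.1.symm.trans hj.1

lemma measureReal_setOf_comp {Ω ι : Type*} [MeasurableSpace Ω] [Fintype ι] (P : Measure Ω)
    [IsFiniteMeasure P] (f : Ω → ι) (hf : ∀ i, MeasurableSet {ω | f ω = i}) (Q : ι → Prop)
    [DecidablePred Q] :
    P.real {ω | Q (f ω)} = ∑ i, if Q i then P.real {ω | f ω = i} else 0 := by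
  have hS : MeasurableSet {ω | Q (f ω)} := by
    have hU : {ω | Q (f ω)} = ⋃ i ∈ {i | Q i}, {ω | f ω = i} := by
      ext ω
      simp
    rw [hU]
    exact MeasurableSet.biUnion (Set.to_countable _) fun i _ => hf i
  rw [measureReal_eq_sum_fiber P f hf hS]
  refine Finset.sum_congr rfl fun i _ => ?_
  split_ifs with h
  · congr 1
    ext ω
    simp only [Set.mem_ofPred_eq, and_iff_left_iff_imp]
    rintro rfl
    exact h
  · convert measureReal_empty (μ := P)
    refine Set.eq_empty_of_forall_notMem ?_
    rintro ω ⟨rfl, hQ⟩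
    exact h hQ

section Row

variable {A : Type*} [Fintype A] {j q : A → ℝ} {w : ℝ}

lemma gibbs_le_row (hj : ∀ a, 0 ≤ j a) (hw : 0 ≤ w) (hq : ∀ a, 0 ≤ q a)
    (hwq : ∀ a, w * q a = 0 → j a = 0) (s : A → ℝ) :
    ∑ a, (j a * s a + j a - w * q a * Real.exp (s a)) ≤
      ∑ a, j a * Real.log (j a / (w * q a)) :=
  Finset.sum_le_sum fun a _ =>
    add_sub_mul_exp_le_mul_log_div (hj a) (mul_nonneg hw (hq a)) (hwq a) (s a)

open Classical in
lemma mass_off_support_le_row (hj : ∀ a, 0 ≤ j a) (hw : 0 ≤ w) (hq : ∀ a, 0 ≤ q a)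
    (hwq : ∀ a, w * q a = 0 → j a = 0) (hjw : ∑ a, j a = w) (hq1 : ∑ a, q a = 1) :
    ∑ a, q a * (if j a = 0 then w else 0) ≤ ∑ a, j a * Real.log (j a / (w * q a)) := by
  have hsum : ∑ a, q a * (if j a = 0 then w else 0) =
      ∑ a, (j a - w * q a + q a * (if j a = 0 then w else 0)) := by
    rw [Finset.sum_add_distrib, Finset.sum_sub_distrib, ← Finset.mul_sum, hjw, hq1]
    ring
  rw [hsum]
  refine Finset.sum_le_sum fun a _ => ?_
  split_ifs with h
  · simp [h, mul_comm]
  · have := add_sub_mul_exp_le_mul_log_div (hj a) (mul_nonneg hw (hq a)) (hwq a) 0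
    simpa using this

variable {b : A} {ε : ℝ}

/-- A row that avoids `b` is informative when `b` has large marginal mass. -/
lemma row_ge_of_eq_zero (hj : ∀ a, 0 ≤ j a) (hw : 0 ≤ w) (hq : ∀ a, 0 ≤ q a)
    (hwq : ∀ a, w * q a = 0 → j a = 0) (hjw : ∑ a, j a = w) (hq1 : ∑ a, q a = 1)
    (hjb : j b = 0) {u : ℝ} (hu : 0 < u) (hqb : (1 - q b) * (1 + u) ≤ 1) :
    w * Real.log (1 + u) ≤ ∑ a, j a * Real.log (j a / (w * q a)) := by
  classical
  have hle : ∑ a, (j a * Real.log (1 + u) + j a -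
      w * (if a = b then 0 else q a) * (1 + u)) ≤ ∑ a, j a * Real.log (j a / (w * q a)) := by
    refine Finset.sum_le_sum fun a _ => ?_
    split_ifs with h
    · simp [h, hjb]
    · have := add_sub_mul_exp_le_mul_log_div (hj a) (mul_nonneg hw (hq a)) (hwq a)
        (Real.log (1 + u))
      rwa [Real.exp_log (by linarith)] at this
  have hoff : ∑ a, (if a = b then 0 else q a) = 1 - q b := by
    have : ∀ a, (if a = b then 0 else q a) = q a - if a = b then q a else 0 := by
      intro a
      split_ifs <;> ring
    simp [this, hq1]
  rw [Finset.sum_sub_distrib, Finset.sum_add_distrib, ← Finset.sum_mul, ← Finset.sum_mul,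
    ← Finset.mul_sum, hoff, hjw] at hle
  nlinarith [mul_le_mul_of_nonneg_left hqb hw]

/-- A row that gives mass at least `ε` to `b` is informative when `b` has small marginal mass. -/
lemma row_ge_of_le (hj : ∀ a, 0 ≤ j a) (hw : 0 ≤ w) (hq : ∀ a, 0 ≤ q a)
    (hwq : ∀ a, w * q a = 0 → j a = 0) (hjw : ∑ a, j a = w) (hq1 : ∑ a, q a = 1)
    (hε0 : 0 < ε) (hε1 : ε < 1) (hjb : ε * w ≤ j b)
    (hqb : 1 ≤ (1 - q b) * (1 + ε * (1 - ε) ^ (1 / ε - 1))) :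
    w * Real.log (1 + ε * (1 - ε) ^ (1 / ε - 1)) ≤
      ∑ a, j a * Real.log (j a / (w * q a)) := by
  classical
  set r := (1 - ε) ^ (1 / ε - 1)
  set u := ε * r with hu
  set C := Real.log (1 + u)
  set l := Real.log (1 - ε)
  have h1ε : 0 < 1 - ε := by linarith
  have hr0 : 0 < r := Real.rpow_pos_of_pos h1ε _
  have hu0 : 0 < u := mul_pos hε0 hr0
  have hl0 : l ≤ 0 := Real.log_nonpos h1ε.le (by linarith)
  have hexp : Real.exp (l + C) = (1 - ε) * (1 + u) := by
    rw [Real.exp_add, Real.exp_log h1ε, Real.exp_log (by linarith)]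
  have hrexp : Real.exp (-l / ε) * ((1 - ε) * r) = 1 := by
    have h1 : r = Real.exp (l * (1 / ε - 1)) := Real.rpow_def_of_pos h1ε _
    have h2 : 1 - ε = Real.exp l := (Real.exp_log h1ε).symm
    rw [h1, h2, ← Real.exp_add, ← Real.exp_add, Real.exp_eq_one_iff]
    ring
  have hle := gibbs_le_row hj hw hq hwq
    (fun a => (l + C) + if a = b then -l / ε else 0)
  have hterm : ∀ a, j a * ((l + C) + if a = b then -l / ε else 0) + j a -
      w * q a * Real.exp ((l + C) + if a = b then -l / ε else 0) =
      j a * (l + C + 1) - q a * (w * ((1 - ε) * (1 + u))) +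
        if a = b then j a * (-l / ε) -
          q a * (w * ((1 - ε) * (1 + u)) * (Real.exp (-l / ε) - 1)) else 0 := by
    intro a
    rw [Real.exp_add, hexp]
    split_ifs
    · ring
    · rw [Real.exp_zero]
      ring
  simp only [hterm] at hle
  rw [Finset.sum_add_distrib, Finset.sum_sub_distrib, ← Finset.sum_mul, ← Finset.sum_mul,
    hjw, hq1] at hle
  simp only [Finset.sum_ite_eq', Finset.mem_univ, if_true] at hle
  have hgain : -l * w ≤ j b * (-l / ε) := by
    calc -l * w = (ε * w) * (-l / ε) := by field_simp
      _ ≤ _ := mul_le_mul_of_nonneg_right hjb (div_nonneg (by linarith) hε0.le)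
  have hnorm : (1 - ε) * (1 + u) + q b * ((1 - ε) * (1 + u) * (Real.exp (-l / ε) - 1)) ≤ 1 := by
    set T := Real.exp (-l / ε)
    have hTu : T * ((1 - ε) * u) = ε := by
      rw [hu]
      linear_combination ε * hrexp
    have hT : (1 - ε) * (T - 1) * u = ε - (1 - ε) * u := by linear_combination hTu
    have hT0 : 0 ≤ T - 1 := by
      have : 0 ≤ -l / ε := div_nonneg (by linarith) hε0.le
      have := Real.one_le_exp this
      linarith
    have hqu : q b * (1 + u) ≤ u := by linarith
    have hmul := mul_le_mul_of_nonneg_left hqu (mul_nonneg h1ε.le hT0)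
    nlinarith
  have hnorm' := mul_le_mul_of_nonneg_left hnorm hw
  linarith

end Row

open Classical in
/-- The information bound for a finite joint mass function `J`. -/
lemma delegation_information_joint {κ A : Type*} [Fintype κ] [Fintype A] (J : κ → A → ℝ)
    (w : κ → ℝ) (q : A → ℝ) (b : A) {ε η : ℝ} (hJ : ∀ k a, 0 ≤ J k a)
    (hJw : ∀ k, ∑ a, J k a = w k) (hJq : ∀ a, ∑ k, J k a = q a) (hw1 : ∑ k, w k = 1)
    (hε0 : 0 < ε) (hε1 : ε < 1)
    (hyp : ∀ a, ∑ k, (if 0 < J k a / w k ∧ (a = b ∨ J k b / w k ≤ ε) then w k else 0) ≤ 1 - η) :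
    η * Real.log (1 + ε * (1 - ε) ^ (1 / ε - 1)) ≤
      ∑ k, ∑ a, J k a * Real.log (J k a / (w k * q a)) := by
  have hw : ∀ k, 0 ≤ w k := fun k => hJw k ▸ Finset.sum_nonneg fun a _ => hJ k a
  have hq : ∀ a, 0 ≤ q a := fun a => hJq a ▸ Finset.sum_nonneg fun k _ => hJ k a
  have hq1 : ∑ a, q a = 1 := by
    rw [← hw1]
    simp only [← hJq, ← hJw]
    exact Finset.sum_comm
  have hJlew : ∀ k a, J k a ≤ w k := fun k a =>
    hJw k ▸ Finset.single_le_sum (fun a _ => hJ k a) (Finset.mem_univ a)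
  have hJleq : ∀ k a, J k a ≤ q a := fun k a =>
    hJq a ▸ Finset.single_le_sum (f := fun k => J k a) (fun k _ => hJ k a) (Finset.mem_univ k)
  have hwq : ∀ k a, w k * q a = 0 → J k a = 0 := fun k a h => by
    rcases mul_eq_zero.mp h with h | h
    · exact le_antisymm (h ▸ hJlew k a) (hJ k a)
    · exact le_antisymm (h ▸ hJleq k a) (hJ k a)
  have hzero : ∀ k a, ¬ 0 < J k a / w k → J k a = 0 := fun k a h => by
    by_contra hne
    have hpos : 0 < J k a := (hJ k a).lt_of_ne (Ne.symm hne)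
    exact h (div_pos hpos (hpos.trans_le (hJlew k a)))
  have hoff := fun k => mass_off_support_le_row (hJ k) (hw k) hq (hwq k) (hJw k) hq1
  have hrow0 : ∀ k, 0 ≤ ∑ a, J k a * Real.log (J k a / (w k * q a)) := fun k =>
    (Finset.sum_nonneg fun a _ => mul_nonneg (hq a) (by split_ifs <;> simp [hw k])).trans (hoff k)
  set r := (1 - ε) ^ (1 / ε - 1)
  have h1ε : 0 < 1 - ε := by linarith
  have hr0 : 0 < r := Real.rpow_pos_of_pos h1ε _
  have hr1 : r ≤ 1 := Real.rpow_le_one h1ε.le (by linarith)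
    (sub_nonneg.mpr ((one_le_div hε0).mpr hε1.le))
  have hu0 : 0 < ε * r := mul_pos hε0 hr0
  have hC0 : 0 ≤ Real.log (1 + ε * r) := Real.log_nonneg (by linarith)
  have hC1 : Real.log (1 + ε * r) ≤ 1 := by
    have := Real.log_le_sub_one_of_pos (show 0 < 1 + ε * r by linarith)
    nlinarith
  set C := Real.log (1 + ε * r)
  set E : κ → A → ℝ := fun k a =>
    if 0 < J k a / w k ∧ (a = b ∨ J k b / w k ≤ ε) then w k else 0 with hE
  have hE' : ∀ a, η ≤ ∑ k, (w k - E k a) := fun a => by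
    rw [Finset.sum_sub_distrib, hw1]
    linarith [hyp a]
  rcases le_total ((1 - q b) * (1 + ε * r)) 1 with hqb | hqb
  · calc η * C ≤ (∑ k, (w k - E k b)) * C := mul_le_mul_of_nonneg_right (hE' b) hC0
      _ = ∑ k, (w k - E k b) * C := Finset.sum_mul _ _ _
      _ ≤ _ := by
        refine Finset.sum_le_sum fun k _ => ?_
        simp only [hE, true_or, and_true]
        split_ifs with h
        · simpa using hrow0 k
        · simpa using row_ge_of_eq_zero (hJ k) (hw k) hq (hwq k) (hJw k) hq1 (hzero k b h) hu0 hqb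
  · have hrow : ∀ k, ∑ a, q a * ((w k - E k a) * C) ≤
        ∑ a, J k a * Real.log (J k a / (w k * q a)) := fun k => by
      by_cases hk : J k b / w k ≤ ε
      · refine le_trans (Finset.sum_le_sum fun a _ => ?_) (hoff k)
        refine mul_le_mul_of_nonneg_left ?_ (hq a)
        simp only [hE, hk, or_true, and_true]
        by_cases h : 0 < J k a / w k
        · simp only [h, if_true, sub_self, zero_mul]
          split_ifs <;> simp [hw k]
        · simpa [h, hzero k a h] using mul_le_of_le_one_right (hw k) hC1
      · have hjb : ε * w k ≤ J k b := by
          rcases (hw k).eq_or_lt with h | h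
          · simpa [← h] using hJ k b
          · exact ((lt_div_iff₀ h).mp (not_le.mp hk)).le
        refine le_trans ?_ (row_ge_of_le (hJ k) (hw k) hq (hwq k) (hJw k) hq1 hε0 hε1 hjb hqb)
        calc ∑ a, q a * ((w k - E k a) * C) ≤ ∑ a, q a * (w k * C) := by
              refine Finset.sum_le_sum fun a _ => mul_le_mul_of_nonneg_left
                (mul_le_mul_of_nonneg_right ?_ hC0) (hq a)
              have : 0 ≤ E k a := by
                simp only [hE]
                split_ifs <;> simp [hw k]
              linarith
          _ = w k * C := by rw [← Finset.sum_mul, hq1, one_mul]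
    calc η * C = ∑ a, q a * (η * C) := by rw [← Finset.sum_mul, hq1, one_mul]
      _ ≤ ∑ a, q a * ((∑ k, (w k - E k a)) * C) := Finset.sum_le_sum fun a _ =>
          mul_le_mul_of_nonneg_left (mul_le_mul_of_nonneg_right (hE' a) hC0) (hq a)
      _ = ∑ k, ∑ a, q a * ((w k - E k a) * C) := by
          rw [Finset.sum_comm]
          simp only [Finset.sum_mul, Finset.mul_sum]
      _ ≤ _ := Finset.sum_le_sum fun k _ => hrow k

/-- **Proposition (information gain from a delegation).** Let `A` be a finite set, `a* ∈ A`,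
`N ∈ ℕ⁺`, `ε ∈ (0, 1/|A|)`, `η ∈ (0,1)`, and let `K`, `X` be random variables on a probability
space `(Ω, P)` valued in `[N]` and `A`. If for every `a ∈ A`,
`P[ P[X=a|K] > 0 ∧ (a = a* ∨ P[X=a*|K] ≤ ε) ] ≤ 1 − η`,
then `I(K;X) ≥ η ln(1 + ε (1−ε)^{1/ε − 1})`, where the mutual information is
`I(K;X) = Σ_{k,a} P[K=k, X=a] ln( P[K=k, X=a] / (P[K=k] P[X=a]) )`
and `P[X=a|K=k] = P[K=k, X=a]/P[K=k]`. -/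
theorem delegation_information
    {Ω : Type*} [MeasurableSpace Ω] (P : Measure Ω) [IsProbabilityMeasure P]
    {A : Type*} [Fintype A] [Nonempty A]
    (astar : A) (N : ℕ) (hN : 0 < N)
    (ε η : ℝ) (hε0 : 0 < ε) (hε1 : ε < 1 / (Fintype.card A : ℝ)) (hη0 : 0 < η) (hη1 : η < 1)
    (K : Ω → Fin N) (X : Ω → A)
    (hK : ∀ k, MeasurableSet {ω | K ω = k}) (hX : ∀ a, MeasurableSet {ω | X ω = a})
    (hyp : ∀ a : A,
      (P {ω | 0 < (P {ω' | K ω' = K ω ∧ X ω' = a}).toReal / (P {ω' | K ω' = K ω}).toReal ∧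
          (a = astar ∨
            (P {ω' | K ω' = K ω ∧ X ω' = astar}).toReal /
                (P {ω' | K ω' = K ω}).toReal ≤ ε)}).toReal ≤ 1 - η) :
    η * Real.log (1 + ε * (1 - ε) ^ (1 / ε - 1)) ≤
      ∑ k : Fin N, ∑ a : A,
        (P {ω | K ω = k ∧ X ω = a}).toReal *
          Real.log ((P {ω | K ω = k ∧ X ω = a}).toReal /
            ((P {ω | K ω = k}).toReal * (P {ω | X ω = a}).toReal)) := by
  classical
  have hcard : (1 : ℝ) ≤ Fintype.card A := by exact_mod_cast Fintype.card_pos (α := A)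
  refine delegation_information_joint (fun k a => P.real {ω | K ω = k ∧ X ω = a})
    (fun k => P.real {ω | K ω = k}) (fun a => P.real {ω | X ω = a}) astar
    (fun _ _ => measureReal_nonneg) (fun k => ?_) (fun a => ?_) ?_ hε0
    (hε1.trans_le ((div_le_one (by linarith)).mpr hcard)) fun a => ?_
  · rw [measureReal_eq_sum_fiber P X hX (hK k)]
    simp only [Set.mem_ofPred_eq, and_comm]
  · exact (measureReal_eq_sum_fiber P K hK (hX a)).symm
  · have := measureReal_eq_sum_fiber P K hK MeasurableSet.univ
    simpa using this.symm
  · refine le_trans (le_of_eq ?_) (hyp a)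
    exact (measureReal_setOf_comp P K hK fun k =>
      0 < P.real {ω | K ω = k ∧ X ω = a} / P.real {ω | K ω = k} ∧
        (a = astar ∨ P.real {ω | K ω = k ∧ X ω = astar} / P.real {ω | K ω = k} ≤ ε)).symm
end

section
/- Let (Ω, P) be a probability space, N ∈ ℕ, η ∈ (0,1), ζ ∈ Δ([N]), R ⊆ [0,1] a finite set, and random variables U: Ω → R, K: Ω → [N], J: Ω → [N]. Assume: (i) both K and J have distribution ζ; (ii) K and J are independent (I(K;J)=0); (iii) ζ(k) ≥ η for every k ∈ supp ζ. Then the mutual information between K and the pair (J,U) satisfies I(K; J, U) ≥ 2η · ( E[ E[U | K, J] restricted to the event J = K, i.e., E_{j∼ζ}[E[U | K=j, J=j]] ] − E[U] )². Explicitly, writing U_{kj} := E[U | K=k, J=j], the bound is I(K; J, U) ≥ 2η ( E_{j∼ζ}[U_{jj}] − E_{k∼ζ, j∼ζ}[U_{kj}] )². -/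
open MeasureTheory
open scoped BigOperators

/-- Hoeffding's lemma for a finitely supported distribution on `[0, 1]`. -/
lemma sum_mul_exp_le_exp_of_mem_Icc (R : Finset ℝ) (hR : ∀ r ∈ R, r ∈ Set.Icc (0 : ℝ) 1)
    (q : ℝ → ℝ) (hq : ∀ r ∈ R, 0 ≤ q r) (hq1 : ∑ r ∈ R, q r = 1) (t : ℝ) :
    ∑ r ∈ R, q r * Real.exp (t * r) ≤ Real.exp (t * (∑ r ∈ R, r * q r) + t ^ 2 / 8) := by
  set μ : Measure ℝ := ∑ r ∈ R, ENNReal.ofReal (q r) • Measure.dirac r with hμ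
  have hint : ∀ f : ℝ → ℝ, ∫ x, f x ∂μ = ∑ r ∈ R, q r * f r := by
    intro f
    rw [hμ, integral_finsetSum_measure]
    · refine Finset.sum_congr rfl fun r hr => ?_
      rw [integral_smul_measure, integral_dirac, ENNReal.toReal_ofReal (hq r hr), smul_eq_mul]
    · intro r _
      exact (integrable_dirac (by simp)).smul_measure ENNReal.ofReal_ne_top
  have hprob : IsProbabilityMeasure μ := by
    constructor
    rw [hμ, Measure.finsetSum_apply]
    simp only [Measure.smul_apply, measure_univ, smul_eq_mul, mul_one]
    rw [← ENNReal.ofReal_sum_of_nonneg hq, hq1, ENNReal.ofReal_one]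
  have hae : ∀ᵐ x ∂μ, x ∈ Set.Icc (0 : ℝ) 1 := by
    rw [ae_iff, hμ, Measure.finsetSum_apply]
    refine Finset.sum_eq_zero fun r hr => ?_
    rw [Measure.smul_apply, Measure.dirac_apply]
    simp [(hR r hr).1, (hR r hr).2]
  have hsub := (ProbabilityTheory.hasSubgaussianMGF_of_mem_Icc (X := fun x => x)
    aemeasurable_id hae).mgf_le t
  simp only [ProbabilityTheory.mgf, hint] at hsub
  have hmean : ∑ r ∈ R, q r * r = ∑ r ∈ R, r * q r :=
    Finset.sum_congr rfl fun r _ => mul_comm _ _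
  rw [hmean] at hsub
  set m := ∑ r ∈ R, r * q r
  calc ∑ r ∈ R, q r * Real.exp (t * r)
      = Real.exp (t * m) * ∑ r ∈ R, q r * Real.exp (t * (r - m)) := by
        rw [Finset.mul_sum]
        refine Finset.sum_congr rfl fun r _ => ?_
        rw [mul_left_comm, ← Real.exp_add]
        ring_nf
    _ ≤ Real.exp (t * m) * Real.exp (t ^ 2 / 8) := by
        refine mul_le_mul_of_nonneg_left (hsub.trans_eq ?_) (Real.exp_pos _).le
        congr 1
        simp
        ring
    _ = _ := (Real.exp_add _ _).symm

/-- Pinsker's inequality for the means of two finitely supported distributions on `[0, 1]`. -/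
lemma two_mul_sq_sub_mean_le_klDiv (R : Finset ℝ) (hR : ∀ r ∈ R, r ∈ Set.Icc (0 : ℝ) 1)
    (p q : ℝ → ℝ) (hp : ∀ r ∈ R, 0 ≤ p r) (hp1 : ∑ r ∈ R, p r = 1)
    (hq : ∀ r ∈ R, 0 ≤ q r) (hq1 : ∑ r ∈ R, q r = 1)
    (hac : ∀ r ∈ R, q r = 0 → p r = 0) :
    2 * ((∑ r ∈ R, r * p r) - ∑ r ∈ R, r * q r) ^ 2 ≤ ∑ r ∈ R, p r * Real.log (p r / q r) := by
  set a := ∑ r ∈ R, r * p r with ha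
  set b := ∑ r ∈ R, r * q r
  set t := 4 * (a - b) with ht
  set c := t * b + t ^ 2 / 8 with hc
  have hZ := sum_mul_exp_le_exp_of_mem_Icc R hR q hq hq1 t
  have hpoint : ∀ r ∈ R, p r * (t * r - c) + p r - q r * Real.exp (t * r) * Real.exp (-c) ≤
      p r * Real.log (p r / q r) := by
    intro r hr
    rcases (hp r hr).eq_or_lt with h0 | h0
    · rw [← h0]
      have := mul_nonneg (mul_nonneg (hq r hr) (Real.exp_pos (t * r)).le) (Real.exp_pos (-c)).le
      linarith
    · have hq0 : 0 < q r := (hq r hr).lt_of_ne fun h => h0.ne' (hac r hr h.symm)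
      have hlog := Real.log_le_sub_one_of_pos
        (show 0 < q r / p r * Real.exp (t * r - c) by positivity)
      rw [Real.log_mul (by positivity) (Real.exp_ne_zero _), Real.log_exp, ← inv_div,
        Real.log_inv] at hlog
      have h := mul_le_mul_of_nonneg_left hlog h0.le
      have he : p r * ((p r / q r)⁻¹ * Real.exp (t * r - c) - 1) =
          q r * Real.exp (t * r) * Real.exp (-c) - p r := by
        rw [sub_eq_add_neg (t * r), Real.exp_add]
        field_simp
      rw [he] at h
      linarith
  have hsum := Finset.sum_le_sum hpoint
  have hleft : ∑ r ∈ R, (p r * (t * r - c) + p r - q r * Real.exp (t * r) * Real.exp (-c)) =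
      t * a - c + 1 - (∑ r ∈ R, q r * Real.exp (t * r)) * Real.exp (-c) := by
    rw [Finset.sum_sub_distrib, Finset.sum_add_distrib, hp1, Finset.sum_mul, ha, Finset.mul_sum]
    have : ∑ r ∈ R, p r * (t * r - c) = ∑ r ∈ R, t * (r * p r) - c * ∑ r ∈ R, p r := by
      rw [Finset.mul_sum, ← Finset.sum_sub_distrib]
      exact Finset.sum_congr rfl fun r _ => by ring
    rw [this, hp1, mul_one]
  have hZ' := mul_le_mul_of_nonneg_right hZ (Real.exp_pos (-c)).le
  rw [← Real.exp_add, add_neg_cancel, Real.exp_zero] at hZ'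
  rw [hleft] at hsum
  have hquad : t * a - c = 2 * (a - b) ^ 2 := by rw [hc, ht]; ring
  linarith

/-- The real masses of the pieces of a set, split according to the values of a function with
finite range, add up to the mass of the set. -/
lemma sum_toReal_measure_inter_fiber {Ω β : Type*} [MeasurableSpace Ω] (P : Measure Ω)
    [IsFiniteMeasure P] (f : Ω → β) (s : Finset β) (hs : ∀ ω, f ω ∈ s)
    (hf : ∀ b, MeasurableSet {ω | f ω = b}) (A : Set Ω) (hA : MeasurableSet A) :
    ∑ b ∈ s, (P (A ∩ {ω | f ω = b})).toReal = (P A).toReal := by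
  rw [← ENNReal.toReal_sum fun _ _ => measure_ne_top P _, ← measure_biUnion_finset]
  · congr 2
    ext ω
    simp [hs]
  · intro b _ c _ hbc
    refine Set.disjoint_left.2 fun ω hb hc => hbc ?_
    exact hb.2.symm.trans hc.2
  · exact fun b _ => hA.inter (hf b)

/-- The information bound for a finite joint mass function `a k j r` whose `(k, j)`-marginal is
the product `ζ k * ζ j`, and whose `(j, r)`-marginal is `b`. -/
lemma information_bound_of_mass_function {ι : Type*} [Fintype ι] (η : ℝ) (hη : 0 ≤ η) (ζ : ι → ℝ)
    (hζ0 : ∀ k, 0 ≤ ζ k) (hζ1 : ∑ k, ζ k = 1) (hsupp : ∀ k, 0 < ζ k → η ≤ ζ k)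
    (R : Finset ℝ) (hR : ∀ r ∈ R, r ∈ Set.Icc (0 : ℝ) 1)
    (a : ι → ι → ℝ → ℝ) (b : ι → ℝ → ℝ) (ha : ∀ k j r, 0 ≤ a k j r)
    (hab : ∀ j r, ∑ k, a k j r = b j r) (haζ : ∀ k j, ∑ r ∈ R, a k j r = ζ k * ζ j)
    (u : ι → ι → ℝ) (hu : ∀ k j, u k j = (∑ r ∈ R, r * a k j r) / (ζ k * ζ j)) :
    2 * η * ((∑ j, ζ j * u j j) - ∑ k, ∑ j, ζ k * ζ j * u k j) ^ 2 ≤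
      ∑ k, ∑ j, ∑ r ∈ R, a k j r * Real.log (a k j r / (ζ k * b j r)) := by
  set v : ι → ℝ := fun j => ∑ k, ζ k * u k j with hv
  have hzero : ∀ k j, ζ k * ζ j = 0 → ∀ r ∈ R, a k j r = 0 := fun k j h =>
    (Finset.sum_eq_zero_iff_of_nonneg fun r _ => ha k j r).1 ((haζ k j).trans h)
  have hbsum : ∀ j, ∑ r ∈ R, b j r = ζ j := by
    intro j
    simp_rw [← hab]
    rw [Finset.sum_comm]
    simp_rw [haζ]
    rw [← Finset.sum_mul, hζ1, one_mul]
  have hpair : ∀ k j, 2 * (ζ k * ζ j * (u k j - v j) ^ 2) ≤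
      ∑ r ∈ R, a k j r * Real.log (a k j r / (ζ k * b j r)) := by
    intro k j
    rcases (mul_nonneg (hζ0 k) (hζ0 j)).eq_or_lt with h0 | h0
    · rw [Finset.sum_eq_zero fun r hr => by rw [hzero k j h0.symm r hr, zero_mul], ← h0]
      simp
    · have hj : 0 < ζ j := pos_of_mul_pos_right h0 (hζ0 k)
      have hk : 0 < ζ k := pos_of_mul_pos_left h0 (hζ0 j)
      have hb0 : ∀ r, 0 ≤ b j r := fun r => hab j r ▸ Finset.sum_nonneg fun i _ => ha i j r
      have hle : ∀ r, a k j r ≤ b j r := fun r =>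
        hab j r ▸ Finset.single_le_sum (f := fun i => a i j r) (fun i _ => ha i j r)
          (Finset.mem_univ k)
      have hpin := two_mul_sq_sub_mean_le_klDiv R hR (fun r => a k j r / (ζ k * ζ j))
        (fun r => b j r / ζ j) (fun r _ => div_nonneg (ha k j r) h0.le)
        (by rw [← Finset.sum_div, haζ, div_self h0.ne'])
        (fun r _ => div_nonneg (hb0 r) hj.le)
        (by rw [← Finset.sum_div, hbsum, div_self hj.ne'])
        (fun r _ h => by
          have hb : b j r = 0 := by simpa [hj.ne'] using h
          have : a k j r = 0 := le_antisymm (hb ▸ hle r) (ha k j r)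
          simp [this])
      have hu' : ∑ r ∈ R, r * (a k j r / (ζ k * ζ j)) = u k j := by
        rw [hu, Finset.sum_div]
        exact Finset.sum_congr rfl fun r _ => by ring
      have hv' : ∑ r ∈ R, r * (b j r / ζ j) = v j := by
        have hterm : ∀ i, ζ i * u i j = ∑ r ∈ R, r * (a i j r / ζ j) := by
          intro i
          rcases (hζ0 i).eq_or_lt with hi | hi
          · rw [← hi, zero_mul]
            refine (Finset.sum_eq_zero fun r hr => ?_).symm
            rw [hzero i j (by rw [← hi, zero_mul]) r hr]
            simp
          · rw [hu, Finset.sum_div, Finset.mul_sum]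
            refine Finset.sum_congr rfl fun r _ => ?_
            field_simp
        simp only [hv, hterm]
        rw [Finset.sum_comm]
        refine Finset.sum_congr rfl fun r _ => ?_
        rw [← Finset.mul_sum, ← Finset.sum_div, hab]
      rw [hu', hv'] at hpin
      calc 2 * (ζ k * ζ j * (u k j - v j) ^ 2) = ζ k * ζ j * (2 * (u k j - v j) ^ 2) := by ring
        _ ≤ _ := mul_le_mul_of_nonneg_left hpin h0.le
        _ = _ := by
          rw [Finset.mul_sum]
          refine Finset.sum_congr rfl fun r _ => ?_
          have harg : a k j r / (ζ k * ζ j) / (b j r / ζ j) = a k j r / (ζ k * b j r) := by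
            rw [div_div, mul_assoc, mul_div_cancel₀ _ hj.ne']
          rw [harg, ← mul_assoc, mul_div_cancel₀ _ h0.ne']
  have hdiff : (∑ j, ζ j * u j j) - ∑ k, ∑ j, ζ k * ζ j * u k j =
      ∑ j, ζ j * (u j j - v j) := by
    rw [Finset.sum_comm, ← Finset.sum_sub_distrib]
    refine Finset.sum_congr rfl fun j _ => ?_
    rw [mul_sub, hv, Finset.mul_sum]
    congr 1
    exact Finset.sum_congr rfl fun k _ => by ring
  have hjensen : (∑ j, ζ j * (u j j - v j)) ^ 2 ≤ ∑ j, ζ j * (u j j - v j) ^ 2 :=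
    (even_two.convexOn_pow (𝕜 := ℝ)).map_sum_le (fun j _ => hζ0 j) hζ1 fun j _ => Set.mem_univ _
  have hηsum : η * ∑ j, ζ j * (u j j - v j) ^ 2 ≤ ∑ j, ζ j * ζ j * (u j j - v j) ^ 2 := by
    rw [Finset.mul_sum]
    refine Finset.sum_le_sum fun j _ => ?_
    rcases (hζ0 j).eq_or_lt with h0 | h0
    · simp [← h0]
    · rw [← mul_assoc]
      gcongr
      exact hsupp j h0
  have hdiag : ∑ j, ζ j * ζ j * (u j j - v j) ^ 2 ≤
      ∑ k, ∑ j, ζ k * ζ j * (u k j - v j) ^ 2 :=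
    Finset.sum_le_sum fun k _ => Finset.single_le_sum
      (f := fun j => ζ k * ζ j * (u k j - v j) ^ 2)
      (fun j _ => mul_nonneg (mul_nonneg (hζ0 k) (hζ0 j)) (sq_nonneg _)) (Finset.mem_univ k)
  calc _ = 2 * (η * (∑ j, ζ j * (u j j - v j)) ^ 2) := by rw [hdiff]; ring
    _ ≤ 2 * ∑ k, ∑ j, ζ k * ζ j * (u k j - v j) ^ 2 := by
      have := mul_le_mul_of_nonneg_left hjensen hη
      linarith
    _ = ∑ k, ∑ j, 2 * (ζ k * ζ j * (u k j - v j) ^ 2) := by simp only [Finset.mul_sum]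
    _ ≤ _ := Finset.sum_le_sum fun k _ => Finset.sum_le_sum fun j _ => hpair k j

/-- **Proposition (posterior-sampling information bound).** Let `(Ω,P)` be a probability
space, `N ∈ ℕ`, `η ∈ (0,1)`, `ζ ∈ Δ([N])`, `R ⊆ [0,1]` finite, and random variables
`U : Ω → R`, `K, J : Ω → [N]` with `K, J` both distributed as `ζ`, independent of each other,
and `ζ(k) ≥ η` on its support. Writing `U_{kj} = E[U | K=k, J=j]`
(`U_{kj} = (Σ_{r∈R} r · P[K=k, J=j, U=r]) / P[K=k, J=j]`), the mutual information between `K`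
and the pair `(J,U)` satisfies
`I(K; J,U) ≥ 2η ( E_{j∼ζ}[U_{jj}] − E_{k∼ζ, j∼ζ}[U_{kj}] )²`. -/
theorem thompson_information_bound
    {Ω : Type*} [MeasurableSpace Ω] (P : Measure Ω) [IsProbabilityMeasure P]
    (N : ℕ) (η : ℝ) (hη0 : 0 < η) (hη1 : η < 1)
    (ζ : Fin N → ℝ) (hζ : (∀ k, 0 ≤ ζ k) ∧ ∑ k, ζ k = 1)
    (R : Finset ℝ) (hR : ∀ r ∈ R, r ∈ Set.Icc (0 : ℝ) 1)
    (U : Ω → ℝ) (hU : ∀ ω, U ω ∈ R)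
    (K J : Ω → Fin N)
    (hKmeas : ∀ k, MeasurableSet {ω | K ω = k})
    (hJmeas : ∀ j, MeasurableSet {ω | J ω = j})
    (hUmeas : ∀ r : ℝ, MeasurableSet {ω | U ω = r})
    -- (i) `K` and `J` both have distribution `ζ`:
    (hKdist : ∀ k, (P {ω | K ω = k}).toReal = ζ k)
    (hJdist : ∀ j, (P {ω | J ω = j}).toReal = ζ j)
    -- (ii) `K` and `J` are independent (equivalently, `I(K;J) = 0`):
    (hindep : ∀ k j, P {ω | K ω = k ∧ J ω = j} = P {ω | K ω = k} * P {ω | J ω = j})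
    -- (iii) every hypothesis in the support of `ζ` has probability at least `η`:
    (hsupp : ∀ k, 0 < ζ k → η ≤ ζ k) :
    (let Ukj : Fin N → Fin N → ℝ := fun k j =>
       (∑ r ∈ R, r * (P {ω | K ω = k ∧ J ω = j ∧ U ω = r}).toReal) /
         (P {ω | K ω = k ∧ J ω = j}).toReal
     2 * η * ((∑ j, ζ j * Ukj j j) - ∑ k, ∑ j, ζ k * ζ j * Ukj k j) ^ 2 ≤
       ∑ k : Fin N, ∑ j : Fin N, ∑ r ∈ R,
         (P {ω | K ω = k ∧ (J ω = j ∧ U ω = r)}).toReal *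
           Real.log ((P {ω | K ω = k ∧ (J ω = j ∧ U ω = r)}).toReal /
             ((P {ω | K ω = k}).toReal * (P {ω | J ω = j ∧ U ω = r}).toReal))) := by
  have hK : ∀ ω, K ω ∈ Finset.univ := fun _ => Finset.mem_univ _
  have hprod : ∀ k j, (P {ω | K ω = k ∧ J ω = j}).toReal = ζ k * ζ j := fun k j => by
    rw [hindep, ENNReal.toReal_mul, hKdist, hJdist]
  intro Ukj
  simp only [hKdist]
  refine information_bound_of_mass_function η hη0.le ζ hζ.1 hζ.2 hsupp R hR
    (fun k j r => (P {ω | K ω = k ∧ J ω = j ∧ U ω = r}).toReal)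
    (fun j r => (P {ω | J ω = j ∧ U ω = r}).toReal) (fun _ _ _ => ENNReal.toReal_nonneg)
    (fun j r => ?_) (fun k j => ?_) Ukj (fun k j => by simp only [Ukj, hprod])
  · rw [← sum_toReal_measure_inter_fiber P K Finset.univ hK hKmeas
      {ω | J ω = j ∧ U ω = r}
      ((hJmeas j).inter (hUmeas r))]
    refine Finset.sum_congr rfl fun k _ => ?_
    congr 2
    ext ω
    simp [and_comm]
  · rw [← hprod, ← sum_toReal_measure_inter_fiber P U R hU hUmeas
      {ω | K ω = k ∧ J ω = j}
      ((hKmeas k).inter (hJmeas j))]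
    refine Finset.sum_congr rfl fun r _ => ?_
    congr 2
    ext ω
    simp [and_assoc]
end

section
/- Let ε ∈ (0,1) and q := 1/(ε + (1−ε)^{1 − 1/ε}). Then q ∈ (0,1), and min( D(0 ‖ qε), D(ε ‖ qε) ) = ln(1 + ε(1−ε)^{1/ε − 1}), where D(p ‖ r) denotes the KL divergence between Bernoulli distributions with parameters p and r. Consequently, if μ, ν are probability distributions on a finite set A and there exists a ∈ A such that either (ν(a) ≥ qε and μ(a) = 0) or (ν(a) ≤ qε and μ(a) ≥ ε), then D_KL(μ ‖ ν) ≥ ln(1 + ε(1−ε)^{1/ε − 1}). -/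
open scoped BigOperators

/-- The KL divergence `D(p ‖ r)` between Bernoulli distributions with parameters `p` and `r`
(with the convention `0 · ln(0/r) = 0`, which holds definitionally here). -/
noncomputable def bernKL (p r : ℝ) : ℝ :=
  p * Real.log (p / r) + (1 - p) * Real.log ((1 - p) / (1 - r))

/-- Tangent-line bound for one summand of a KL divergence, with a free weight `w`. -/
theorem mul_log_div_ge {m n w : ℝ} (hm : 0 ≤ m) (hn : 0 ≤ n) (hw : 0 ≤ w)
    (hmn : 0 < m → 0 < n) (hmw : 0 < m → 0 < w) :
    m * Real.log w + m - n * w ≤ m * Real.log (m / n) := by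
  rcases hm.eq_or_lt with rfl | hm
  · simpa using mul_nonneg hn hw
  · have hn := hmn hm
    have hw := hmw hm
    have h := mul_le_mul_of_nonneg_left
      (Real.log_le_sub_one_of_pos (div_pos (mul_pos hn hw) hm)) hm.le
    have e : m * (n * w / m - 1) = n * w - m := by field_simp
    rw [e, Real.log_div (mul_pos hn hw).ne' hm.ne', Real.log_mul hn.ne' hw.ne'] at h
    rw [Real.log_div hm.ne' hn.ne']
    linarith

/-- Variational lower bound on the KL divergence by test weights taking the value `W` at `a`
and `V` elsewhere. -/
theorem kl_ge_two_valued {A : Type*} [Fintype A] {μ ν : A → ℝ}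
    (hμ : ∀ a, 0 ≤ μ a) (hμ1 : ∑ a, μ a = 1) (hν : ∀ a, 0 ≤ ν a) (hν1 : ∑ a, ν a = 1)
    (hs : ∀ a, 0 < μ a → 0 < ν a) (a : A) {W V : ℝ} (hW : 0 ≤ W) (hV : 0 < V)
    (hWa : 0 < μ a → 0 < W) (hWV : ν a * W + (1 - ν a) * V ≤ 1) :
    μ a * Real.log W + (1 - μ a) * Real.log V ≤ ∑ b, μ b * Real.log (μ b / ν b) := by
  classical
  have hterm : ∀ b ∈ Finset.univ.erase a,
      μ b * Real.log V + μ b - ν b * V ≤ μ b * Real.log (μ b / ν b) := fun b _ =>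
    mul_log_div_ge (hμ b) (hν b) hV.le (hs b) fun _ => hV
  have hsum := Finset.sum_le_sum hterm
  have ha := mul_log_div_ge (hμ a) (hν a) hW (hs a) hWa
  rw [Finset.sum_sub_distrib, Finset.sum_add_distrib, ← Finset.sum_mul, ← Finset.sum_mul] at hsum
  rw [← Finset.add_sum_erase _ _ (Finset.mem_univ a)] at hμ1 hν1 ⊢
  rw [eq_sub_of_add_eq' hμ1, eq_sub_of_add_eq' hν1] at hsum
  linarith

/-- **Minimal information gain.** Let `ε ∈ (0,1)` and `q := 1/(ε + (1−ε)^{1 − 1/ε})`. Then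
`q ∈ (0,1)` and `min(D(0 ‖ qε), D(ε ‖ qε)) = ln(1 + ε(1−ε)^{1/ε − 1})`. Consequently, for any
probability distributions `μ, ν` on a finite set `A` with `supp μ ⊆ supp ν`, if there is
`a ∈ A` with either (`ν(a) ≥ qε` and `μ(a) = 0`) or (`ν(a) ≤ qε` and `μ(a) ≥ ε`), then
`D_KL(μ ‖ ν) ≥ ln(1 + ε(1−ε)^{1/ε − 1})`. -/
theorem min_bernoulli_kl_and_consequence (ε : ℝ) (hε0 : 0 < ε) (hε1 : ε < 1) :
    let q : ℝ := 1 / (ε + (1 - ε) ^ (1 - 1 / ε))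
    (0 < q ∧ q < 1) ∧
      min (bernKL 0 (q * ε)) (bernKL ε (q * ε)) =
        Real.log (1 + ε * (1 - ε) ^ (1 / ε - 1)) ∧
      ∀ (A : Type) [Fintype A] (μ ν : A → ℝ),
        ((∀ a, 0 ≤ μ a) ∧ ∑ a, μ a = 1) →
        ((∀ a, 0 ≤ ν a) ∧ ∑ a, ν a = 1) →
        (∀ a, 0 < μ a → 0 < ν a) →
        (∃ a, (q * ε ≤ ν a ∧ μ a = 0) ∨ (ν a ≤ q * ε ∧ ε ≤ μ a)) →
        Real.log (1 + ε * (1 - ε) ^ (1 / ε - 1)) ≤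
          ∑ a, μ a * Real.log (μ a / ν a) := by
  intro q
  have h1ε : 0 < 1 - ε := by linarith
  set t : ℝ := (1 - ε) ^ (1 - 1 / ε) with ht
  have hexp : 1 - 1 / ε < 0 := by
    have := one_lt_one_div hε0 hε1
    linarith
  have ht1 : 1 < t := Real.one_lt_rpow_of_pos_of_lt_one_of_neg h1ε (by linarith) hexp
  have ht0 : 0 < t := by linarith
  have hεt : 0 < ε + t := by linarith
  have hs : (1 - ε) ^ (1 / ε - 1) = t⁻¹ := by
    rw [ht, ← Real.rpow_neg h1ε.le, neg_sub]
  have hlogt : ε * Real.log t = (ε - 1) * Real.log (1 - ε) := by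
    rw [ht, Real.log_rpow h1ε]
    field_simp
  have hval : 1 + ε * (1 - ε) ^ (1 / ε - 1) = (ε + t) / t := by
    rw [hs]
    field_simp
    ring
  have hr : q * ε = ε / (ε + t) := by
    simp only [q]
    ring
  have hr1 : 1 - q * ε = t / (ε + t) := by
    rw [hr]
    field_simp
    ring
  have hkey : ε * Real.log (ε + t) + (1 - ε) * Real.log ((1 - ε) * (ε + t) / t) =
      Real.log ((ε + t) / t) := by
    rw [Real.log_div (by positivity) ht0.ne', Real.log_mul h1ε.ne' hεt.ne',
      Real.log_div hεt.ne' ht0.ne']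
    linear_combination hlogt
  have hD0 : bernKL 0 (q * ε) = Real.log ((ε + t) / t) := by
    simp [bernKL, hr1]
  have hDε : bernKL ε (q * ε) = Real.log ((ε + t) / t) := by
    have e1 : ε / (ε / (ε + t)) = ε + t := by field_simp
    have e2 : (1 - ε) / (t / (ε + t)) = (1 - ε) * (ε + t) / t := by field_simp
    rw [bernKL, hr1, hr, e1, e2, hkey]
  refine ⟨⟨by positivity, ?_⟩, ?_, ?_⟩
  · exact (div_lt_one hεt).2 (by linarith)
  · rw [hD0, hDε, min_self, hval]
  · rintro A _ μ ν ⟨hμ, hμ1⟩ ⟨hν, hν1⟩ hsupp ⟨a, ⟨hνa, hμa⟩ | ⟨hνa, hμa⟩⟩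
    · have hc : ν a * 0 + (1 - ν a) * ((ε + t) / t) ≤ 1 := by
        have h : 1 - ν a ≤ t / (ε + t) := by linarith
        calc ν a * 0 + (1 - ν a) * ((ε + t) / t) ≤ t / (ε + t) * ((ε + t) / t) := by
              rw [mul_zero, zero_add]
              gcongr
          _ = 1 := by field_simp
      have h := kl_ge_two_valued hμ hμ1 hν hν1 hsupp a le_rfl (div_pos hεt ht0)
        (fun h => absurd hμa h.ne') hc
      rw [hval]
      simpa [hμa] using h
    · have hV : 0 < (1 - ε) * (ε + t) / t := by positivity
      have hVW : (1 - ε) * (ε + t) / t ≤ ε + t := by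
        rw [div_le_iff₀ ht0, mul_comm (ε + t)]
        gcongr
        linarith
      have hc : ν a * (ε + t) + (1 - ν a) * ((1 - ε) * (ε + t) / t) ≤ 1 := by
        have e : q * ε * (ε + t) + (1 - q * ε) * ((1 - ε) * (ε + t) / t) = 1 := by
          rw [hr1, hr]
          field_simp
          ring
        linarith [mul_le_mul_of_nonneg_right hνa (sub_nonneg.2 hVW)]
      have h := kl_ge_two_valued hμ hμ1 hν hν1 hsupp a hεt.le hV (fun _ => hεt) hc
      rw [hval, ← hkey]
      linarith [mul_le_mul_of_nonneg_right hμa (sub_nonneg.2 (Real.log_le_log hV hVW))]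
end
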